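/- (Accelerated linearized ALM, Nesterov's first scheme, strongly convex case.) Consider minimizing g(y) = g1(y) + g2(y) over y ∈ ℝ^n subject to By = b, where g1 : ℝ^n → ℝ is lower semicontinuous and μ_g-strongly convex (μ_g > 0), g2 : ℝ^n → ℝ is convex and differentiable with L_{g2}-Lipschitz gradient, and the saddle point set Ω of the Lagrangian 𝓛(y,λ) = g(y) + ⟨λ, By − b⟩ is nonempty. Let (y*, λ*) ∈ Ω. Let the iterates, started from y_1 = y_0 ∈ ℝ^n, v_1 = y_1, λ_1 ∈ ℝ^p, with β, γ > 0 and {t_k}_{k≥1} ⊆ [1, +∞) nondecreasing satisfying t_{k+1}² ≤ t_k² + t_{k+1} and t_{k+1}² ≤ t_k² + β·μ_g·t_k, be given for k ≥ 1 by: ȳ_k = y_k + ((t_k − 1)/t_{k+1})·(y_k − y_{k−1}); λ̄_{k+1} = λ_k + γ·t_{k+1}·(B v_k − b); v_{k+1} − v_k = −(β/t_{k+1})·(ζ_{k+1} + ∇g2(ȳ_k) + Bᵀλ̄_{k+1}) for some ζ_{k+1} ∈ ∂g1(v_{k+1}) (equivalently v_{k+1} = Prox_{β/t_{k+1}, g1}(v_k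 − (β/t_{k+1})·(Bᵀλ̄_{k+1} + ∇g2(ȳ_k)))); y_{k+1} = (1/t_{k+1})·v_{k+1} + ((t_{k+1} − 1)/t_{k+1})·y_k; λ_{k+1} = λ_k + γ·t_{k+1}·(B v_{k+1} − b). If β ≤ t_1²/(L_{g2} + t_1²·γ·‖B‖²), then for all k ≥ 1: ‖B y_k − b‖ ≤ C_4/t_k² and |g(y_k) − g(y*)| ≤ (E_1 + C_4·‖λ*‖)/t_k², where E_1 = t_1²·(g(y_1) − g(y*) + ⟨λ*, B y_1 − b⟩) + (t_1²/(2β))·‖y_1 − y*‖² + (1/(2γ))·‖λ_1 − λ*‖² and C_4 = 3·t_1²·‖B y_1 − b‖ + (2‖λ_1 − λ*‖ + 2√(2γ·E_1))/γ. -/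

import Mathlib

set_option autoImplicit false

open RealInnerProductSpace

/-- The polynomial inequality behind `start_inverse_bound`. -/
theorem start_poly {w t U : ℝ} (hw : 1 ≤ w) (hwt : w ≤ t) (htU : t ≤ U)
    (h : t ^ 2 - w ^ 2 ≤ t) :
    0 ≤ (w - 1) * U ^ 3 + (t ^ 2 - w ^ 2) * U ^ 2 - w * (w - t + (t ^ 2 - w ^ 2)) * U ^ 2
      - (t ^ 2 - w ^ 2) * (w - t + (t ^ 2 - w ^ 2)) * U + (t ^ 2 - w ^ 2) * w ^ 2 := by
  obtain ⟨x, rfl⟩ : ∃ x, t = w + x := ⟨t - w, by ring⟩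
  obtain ⟨z, rfl⟩ : ∃ z, U = w + x + z := ⟨U - (w + x), by ring⟩
  obtain ⟨q, rfl⟩ : ∃ q, w = 1 + q := ⟨w - 1, by ring⟩
  have hq : 0 ≤ q := by linarith
  have hx : 0 ≤ x := by linarith
  have hz : 0 ≤ z := by linarith
  have hδ : (2 * (1 + q) + x) * x ≤ 1 + q + x := by linear_combination h
  have hx1 : x ≤ 1 := by nlinarith
  have hxx : x ^ 2 ≤ x := by nlinarith
  obtain ⟨T, hT⟩ : ∃ T, T = 1 + q + x := ⟨_, rfl⟩
  obtain ⟨N, hN⟩ : ∃ N, N = x * (1 + 2 * q + x) := ⟨_, rfl⟩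
  have hN0 : 0 ≤ N := by rw [hN]; positivity
  have hT0 : 0 ≤ T := by linarith
  have hNW : N ≤ T - x := by rw [hN, hT]; linear_combination hδ
  have hδT : N + x ≤ T := by linarith
  have c2 : 0 ≤ 3 * q * T + x - q * N := by nlinarith [mul_nonneg hq hT0]
  have c1 : 0 ≤ 3 * q * T ^ 2 + 2 * T * x - 2 * T * q * N - (N + x) * N := by
    have h1 : 0 ≤ (T - x - N) * (2 * (q * T)) :=
      mul_nonneg (by linarith) (by positivity)
    have h2 : (N + x) * N ≤ T * N := mul_le_mul_of_nonneg_right hδT hN0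
    have h3 : N ≤ 2 * x + q * T := by rw [hN, hT]; nlinarith [mul_nonneg hq hx]
    have h4 : T * N ≤ T * (2 * x + q * T) := mul_le_mul_of_nonneg_left h3 hT0
    have h5 : 0 ≤ q * T * x := by positivity
    nlinarith
  have c0 : 0 ≤ q * T ^ 2 * (T - N) + T ^ 2 * x - T * (N + x) * N + (N + x) * (1 + q) ^ 2 := by
    have h1 : T * (N + x) * N ≤ T * T * N := by gcongr
    have h2 : 0 ≤ q * T ^ 2 * (T - N - x) := mul_nonneg (by positivity) (by linarith)
    have h3 : T ^ 2 ≤ (1 + q) ^ 2 + (1 + q) + x := by rw [hT]; nlinarith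
    have h4 : T ^ 2 * (q + x) ≤ ((1 + q) ^ 2 + (1 + q) + x) * (q + x) :=
      mul_le_mul_of_nonneg_right h3 (by linarith)
    have h5 : ((1 + q) ^ 2 + (1 + q) + x) * (q + x) ≤ (2 * (1 + q) + x) * (1 + q) ^ 2 := by
      nlinarith [mul_nonneg hq hx, mul_nonneg hq hq, mul_nonneg (mul_nonneg hq hq) hq]
    have h6 : 0 ≤ x * ((2 * (1 + q) + x) * (1 + q) ^ 2 - T ^ 2 * (q + x)) :=
      mul_nonneg hx (by linarith)
    have h7 : x * ((2 * (1 + q) + x) * (1 + q) ^ 2 - T ^ 2 * (q + x))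
        = T ^ 2 * x * (1 + q) + (N + x) * (1 + q) ^ 2 - T ^ 2 * N := by
      rw [hN]; ring
    nlinarith
  have e : (2 * (1 + q) + x) * x = N + x := by rw [hN]; ring
  have key : 0 ≤ q * z ^ 3 + (3 * q * T + x - q * N) * z ^ 2
      + (3 * q * T ^ 2 + 2 * T * x - 2 * T * q * N - (N + x) * N) * z
      + (q * T ^ 2 * (T - N) + T ^ 2 * x - T * (N + x) * N + (N + x) * (1 + q) ^ 2) := by
    have := mul_nonneg hq (pow_nonneg hz 3)
    have := mul_nonneg c2 (sq_nonneg z)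
    have := mul_nonneg c1 hz
    linarith
  rw [hN, hT] at key
  linear_combination key

theorem start_inverse_bound {c w t U : ℝ} (hc : 0 < c) (hw : 1 ≤ w) (hwt : w ≤ t) (htU : t ≤ U)
    (hwU : w < U) (h : t ^ 2 - w ^ 2 ≤ t) (hcw : t ^ 2 - w ^ 2 ≤ c * w) :
    ((t ^ 2 - w ^ 2) / c + (t ^ 2 - w ^ 2) - t) * (1 / U + c / U ^ 2)
      ≤ c * (U / (U ^ 2 - w ^ 2)) + (1 - 1 / w) := by
  have hw0 : 0 < w := by linarith
  have hU0 : 0 < U := by linarith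
  have hX : 0 < U ^ 2 - w ^ 2 := by nlinarith
  have hpoly := start_poly hw hwt htU h
  have hδ0 : 0 ≤ t ^ 2 - w ^ 2 := by nlinarith
  generalize t ^ 2 - w ^ 2 = δ at *
  have hd : δ / c ≤ w := by rw [div_le_iff₀ hc]; linarith
  have hcd : δ / w ≤ c := by rw [div_le_iff₀ hw0]; linarith
  have h1 : (δ / c + δ - t) * (1 / U + c / U ^ 2)
      ≤ (w + δ - t) * (1 / U) + (δ + δ / w * (δ - t)) / U ^ 2 := by
    have e1 : (δ / c + δ - t) * (1 / U + c / U ^ 2)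
        = (δ / c + δ - t) * (1 / U) + (δ + c * (δ - t)) / U ^ 2 := by
      field_simp
      ring
    rw [e1]
    have : c * (δ - t) ≤ δ / w * (δ - t) := mul_le_mul_of_nonpos_right hcd (by linarith)
    gcongr
  have h2 : c / U + c * w ^ 2 / U ^ 3 ≤ c * (U / (U ^ 2 - w ^ 2)) := by
    have : c * (U / (U ^ 2 - w ^ 2)) - (c / U + c * w ^ 2 / U ^ 3)
        = c * w ^ 4 / (U ^ 3 * (U ^ 2 - w ^ 2)) := by
      field_simp
      ring
    have : 0 ≤ c * w ^ 4 / (U ^ 3 * (U ^ 2 - w ^ 2)) := by positivity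
    linarith
  have h3 : δ / w / U + δ / w * w ^ 2 / U ^ 3 ≤ c / U + c * w ^ 2 / U ^ 3 := by gcongr
  have h4 : 0 ≤ δ / w / U + δ / w * w ^ 2 / U ^ 3 + (1 - 1 / w)
      - ((w + δ - t) * (1 / U) + (δ + δ / w * (δ - t)) / U ^ 2) := by
    have e : δ / w / U + δ / w * w ^ 2 / U ^ 3 + (1 - 1 / w)
      - ((w + δ - t) * (1 / U) + (δ + δ / w * (δ - t)) / U ^ 2)
      = ((w - 1) * U ^ 3 + δ * U ^ 2 - w * (w - t + δ) * U ^ 2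
      - δ * (w - t + δ) * U + δ * w ^ 2) / (w * U ^ 3) := by
      field_simp
      ring
    rw [e]
    exact div_nonneg hpoly (by positivity)
  linarith

/-- The deficit created by replacing `w` with `t` in the first step is covered by the two gains
accumulated up to the final parameter `U`. -/
theorem start_gain {c w t U : ℝ} (hc : 0 < c) (hw : 1 ≤ w) (hwt : w ≤ t) (htU : t ≤ U)
    (h : t ^ 2 - w ^ 2 ≤ t) (hcw : t ^ 2 - w ^ 2 ≤ c * w) :
    (t ^ 2 - w ^ 2) / c + (t ^ 2 - w ^ 2) - t
      ≤ U / (U ^ 2 - w ^ 2) * (t ^ 2 - w ^ 2) / (1 + c * (U / (U ^ 2 - w ^ 2)))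
        + (t ^ 2 - t) / (1 + (1 / U + c / U ^ 2) * (t ^ 2 - t)) := by
  have hw0 : 0 < w := by linarith
  have hU0 : 0 < U := by linarith
  have hX : 0 ≤ U ^ 2 - w ^ 2 := by nlinarith
  have hu : 0 ≤ t ^ 2 - t := by nlinarith
  have hδ0 : 0 ≤ t ^ 2 - w ^ 2 := by nlinarith
  obtain ⟨R, hR⟩ : ∃ R, R = (t ^ 2 - w ^ 2) / c + (t ^ 2 - w ^ 2) - t := ⟨_, rfl⟩
  rw [← hR]
  rcases le_or_gt R 0 with hR0 | hR0
  · refine hR0.trans ?_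
    positivity
  have hwt' : w < t := by
    refine lt_of_le_of_ne hwt ?_
    rintro rfl
    simp at hR
    linarith
  have hG := start_inverse_bound hc hw hwt htU (hwt'.trans_le htU) h hcw
  rw [← hR] at hG
  obtain ⟨κ, hκ⟩ : ∃ κ, κ = U / (U ^ 2 - w ^ 2) := ⟨_, rfl⟩
  obtain ⟨e, he⟩ : ∃ e, e = 1 / U + c / U ^ 2 := ⟨_, rfl⟩
  obtain ⟨u, hu'⟩ : ∃ u, u = t ^ 2 - t := ⟨_, rfl⟩
  have hκ0 : 0 ≤ κ := by rw [hκ]; positivity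
  have he0 : 0 ≤ e := by rw [he]; positivity
  have hd : (t ^ 2 - w ^ 2) / c ≤ w := by rw [div_le_iff₀ hc]; linarith
  rw [← hκ, ← he] at hG
  rw [← hκ, ← he, ← hu']
  rw [← hu'] at hu
  have hRd : c * R ≤ t ^ 2 - w ^ 2 := by
    rw [mul_comm, ← le_div_iff₀ hc]; linarith
  have hA : R - R / (1 + c * κ) ≤ κ * (t ^ 2 - w ^ 2) / (1 + c * κ) := by
    have : R - R / (1 + c * κ) = κ * (c * R) / (1 + c * κ) := by
      field_simp
      ring
    rw [this]
    gcongr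
  have hB : R / (1 + c * κ) ≤ u / (1 + e * u) := by
    rw [div_le_div_iff₀ (by positivity) (by positivity)]
    have h1 : u * (R * e) ≤ u * (c * κ + (1 - 1 / w)) := by gcongr
    have h2 : u * (1 - 1 / w) ≤ w ^ 2 - w := by
      have : w ^ 2 - w = w ^ 2 * (1 - 1 / w) := by field_simp
      rw [this]
      have : 0 ≤ 1 - 1 / w := by
        rw [sub_nonneg, div_le_one hw0]; exact hw
      gcongr
      linarith
    nlinarith
  linarith

section Potential

variable {E F : Type*} [NormedAddCommGroup E] [InnerProductSpace ℝ E]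
  [NormedAddCommGroup F] [InnerProductSpace ℝ F]

theorem parallel_sum_norm_sq_le {p s m : ℝ} (hps : 0 < p + s) (hm : m * (p + s) ≤ p * s)
    (x z : E) : m * ‖x‖ ^ 2 ≤ p * ‖z - x‖ ^ 2 + s * ‖z‖ ^ 2 := by
  have h := sq_nonneg ‖(p + s) • z - p • x‖
  rw [norm_sub_sq_real, norm_smul, norm_smul, inner_smul_left, inner_smul_right, mul_pow,
    mul_pow, Real.norm_eq_abs, Real.norm_eq_abs, sq_abs, sq_abs] at h
  simp only [conj_trivial] at h
  have h2 := mul_le_mul_of_nonneg_right hm (sq_nonneg ‖x‖)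
  rw [norm_sub_sq_real]
  refine le_of_mul_le_mul_left ?_ hps
  linarith

/-- The slack of a step, together with a multiple of `‖z‖ ^ 2`, controls a multiple of `‖a‖ ^ 2`. -/
theorem slack_norm_sq_le (B : E →L[ℝ] F) {c ρ κ : ℝ} (hc : 0 < c) (hρ : 0 ≤ ρ) (hκ : 0 ≤ κ)
    (hB : ∀ z, ρ * ‖B z‖ ^ 2 ≤ ‖z‖ ^ 2) (a z : E) :
    κ / (1 + c * κ) * ‖a‖ ^ 2 ≤
      (‖z - a‖ ^ 2 - ρ * ‖B (z - a)‖ ^ 2 + ρ * ‖B a‖ ^ 2) / c + κ * ‖z‖ ^ 2 := by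
  have h := hB ((1 + c * κ) • z - a)
  rw [map_sub, map_smul, norm_sub_sq_real, norm_sub_sq_real, norm_smul, norm_smul,
    inner_smul_left, inner_smul_left, mul_pow, mul_pow, Real.norm_eq_abs, sq_abs] at h
  simp only [conj_trivial] at h
  rw [map_sub, norm_sub_sq_real, norm_sub_sq_real]
  have hk : 0 < 1 + c * κ := by positivity
  have h1 : 0 ≤ ρ * ‖B a‖ ^ 2 := by positivity
  have h2 : 0 ≤ c * κ * (1 + c * κ) * (ρ * ‖B z‖ ^ 2) := by positivity
  rw [← sub_nonneg]
  have e : (‖z‖ ^ 2 - 2 * inner ℝ z a + ‖a‖ ^ 2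
        - ρ * (‖B z‖ ^ 2 - 2 * inner ℝ (B z) (B a) + ‖B a‖ ^ 2) + ρ * ‖B a‖ ^ 2) / c
        + κ * ‖z‖ ^ 2 - κ / (1 + c * κ) * ‖a‖ ^ 2
      = ((1 + c * κ) * (‖z‖ ^ 2 - 2 * inner ℝ z a + ‖a‖ ^ 2
        - ρ * (‖B z‖ ^ 2 - 2 * inner ℝ (B z) (B a) + ‖B a‖ ^ 2) + ρ * ‖B a‖ ^ 2)
        + c * κ * (1 + c * κ) * ‖z‖ ^ 2 - c * κ * ‖a‖ ^ 2) / (c * (1 + c * κ)) := by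
    field_simp
  rw [e]
  refine div_nonneg ?_ (by positivity)
  linarith

theorem gain_mul_le {w T U : ℝ} (hw : 1 ≤ w) (hwT : w ≤ T) (hTU : T ≤ U) :
    U / (U ^ 2 - w ^ 2) * (T ^ 2 - w ^ 2) ≤ T := by
  have hX : 0 ≤ U ^ 2 - w ^ 2 := by nlinarith
  rw [div_mul_eq_mul_div]
  refine div_le_of_le_mul₀ hX (by linarith) ?_
  have hUT : 0 ≤ U * T + w ^ 2 := by nlinarith
  nlinarith [mul_nonneg (sub_nonneg.2 hTU) hUT]

theorem div_one_add_mul_sub_le {e p q : ℝ} (he : 0 ≤ e) (hq : 0 ≤ q) (hqp : q ≤ p) :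
    p / (1 + e * p) - q / (1 + e * q) ≤ p - q := by
  have hp : 0 ≤ p := hq.trans hqp
  have e1 : p / (1 + e * p) - q / (1 + e * q) = (p - q) / ((1 + e * p) * (1 + e * q)) := by
    field_simp
    ring
  rw [e1]
  refine div_le_self (by linarith) ?_
  have : 0 ≤ e * p := by positivity
  have : 0 ≤ e * q := by positivity
  nlinarith

/-- If the per-step energy inequality holds with the initial parameter `t 1` limiting the step size,
then the final energy is bounded by the initial energy weighted with `t 1 ^ 2`. -/
theorem energy_le_of_step (B : E →L[ℝ] F) {c ρ : ℝ} (hc : 0 < c) (hρ : 0 ≤ ρ)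
    (hB : ∀ z, ρ * ‖B z‖ ^ 2 ≤ ‖z‖ ^ 2)
    {t D Λ : ℕ → ℝ} {a x : ℕ → E}
    (ht1 : ∀ k ≥ 1, 1 ≤ t k) (htmono : ∀ k ≥ 1, t k ≤ t (k + 1))
    (htrec : ∀ k ≥ 1, t (k + 1) ^ 2 ≤ t k ^ 2 + t (k + 1))
    (htrec2 : ∀ k ≥ 1, t (k + 1) ^ 2 ≤ t k ^ 2 + c * t k)
    (hstart : a 1 = x 1)
    (hx : ∀ k ≥ 1, x (k + 1) = (1 / t (k + 1)) • a (k + 1) + ((t (k + 1) - 1) / t (k + 1)) • x k)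
    (hD : ∀ k ≥ 1, ‖x k‖ ^ 2 ≤ D k)
    (hstep : ∀ k ≥ 1,
      t (k + 1) ^ 2 * D (k + 1) + (t (k + 1) ^ 2 / c + t (k + 1)) * ‖a (k + 1)‖ ^ 2 + Λ (k + 1)
        + (t (k + 1) - 1) * ‖a (k + 1) - x k‖ ^ 2
        + (t (k + 1) ^ 2 - t 1 ^ 2) * ((‖a (k + 1) - a k‖ ^ 2 - ρ * ‖B (a (k + 1) - a k)‖ ^ 2
          + ρ * ‖B (a k)‖ ^ 2) / c)
      ≤ (t (k + 1) ^ 2 - t (k + 1)) * D k + t (k + 1) ^ 2 / c * ‖a k‖ ^ 2 + Λ k)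
    {K : ℕ} (hK : 1 ≤ K) :
    t K ^ 2 * D K + Λ K ≤ t 1 ^ 2 * D 1 + t 1 ^ 2 / c * ‖a 1‖ ^ 2 + Λ 1 := by
  obtain ⟨m, rfl⟩ : ∃ m, K = m + 1 := ⟨K - 1, by omega⟩
  rcases Nat.eq_zero_or_pos m with rfl | hm
  · have : 0 ≤ t 1 ^ 2 / c * ‖a 1‖ ^ 2 := by positivity
    simp only [zero_add]
    linarith
  have hmono : ∀ i j, 1 ≤ i → i ≤ j → t i ≤ t j := by
    intro i j hi hij
    induction j, hij using Nat.le_induction with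
    | base => exact le_rfl
    | succ j hj ih => exact ih.trans (htmono j (hi.trans hj))
  obtain ⟨U, hU⟩ : ∃ U, U = t (m + 1) := ⟨_, rfl⟩
  have hw := ht1 1 le_rfl
  have hwU : t 1 ≤ U := hU ▸ hmono 1 (m + 1) le_rfl (by omega)
  have hU0 : 0 < U := by linarith
  obtain ⟨κ, hκ⟩ : ∃ κ, κ = U / (U ^ 2 - t 1 ^ 2) := ⟨_, rfl⟩
  obtain ⟨e, he⟩ : ∃ e, e = 1 / U + c / U ^ 2 := ⟨_, rfl⟩
  have hκ0 : 0 ≤ κ := by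
    rw [hκ]; exact div_nonneg hU0.le (by nlinarith)
  have he0 : 0 ≤ e := by rw [he]; positivity
  -- slack in the step inequality turned into a multiple of `‖a k‖ ^ 2`
  have hslack : ∀ k ≥ 1, κ * (t (k + 1) ^ 2 - t 1 ^ 2) / (1 + c * κ) * ‖a k‖ ^ 2 ≤
      (t (k + 1) ^ 2 - t 1 ^ 2) * ((‖a (k + 1) - a k‖ ^ 2 - ρ * ‖B (a (k + 1) - a k)‖ ^ 2
          + ρ * ‖B (a k)‖ ^ 2) / c) + κ * (t (k + 1) ^ 2 - t 1 ^ 2) * ‖a (k + 1)‖ ^ 2 := by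
    intro k hk
    have hX : 0 ≤ t (k + 1) ^ 2 - t 1 ^ 2 := by
      have := hmono 1 (k + 1) le_rfl (by omega)
      nlinarith
    have := mul_le_mul_of_nonneg_left (slack_norm_sq_le B hc hρ hκ0 hB (a k) (a (k + 1))) hX
    calc _ = (t (k + 1) ^ 2 - t 1 ^ 2) * (κ / (1 + c * κ) * ‖a k‖ ^ 2) := by ring
      _ ≤ _ := this
      _ = _ := by ring
  have hF : ∀ j ≥ 1, j ≤ m →
      (t (j + 1) ^ 2 - t (j + 1)) * D j + t (j + 1) ^ 2 / c * ‖a j‖ ^ 2 + Λ j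
        - κ * (t (j + 1) ^ 2 - t 1 ^ 2) / (1 + c * κ) * ‖a j‖ ^ 2
        - (t (j + 1) ^ 2 - t (j + 1)) / (1 + e * (t (j + 1) ^ 2 - t (j + 1))) * ‖x j‖ ^ 2
      ≤ t 1 ^ 2 * D 1 + t 1 ^ 2 / c * ‖a 1‖ ^ 2 + Λ 1 := by
    intro j hj
    induction j, hj using Nat.le_induction with
    | base =>
      intro _
      have h2 := htrec 1 le_rfl
      have h3 := htrec2 1 le_rfl
      have hG := start_gain hc hw (htmono 1 le_rfl) (hU ▸ hmono (1 + 1) (m + 1) (by omega)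
        (by omega)) (by linarith : t (1 + 1) ^ 2 - t 1 ^ 2 ≤ t (1 + 1))
        (by linarith)
      rw [← hκ, ← he] at hG
      have hD1 := hD 1 le_rfl
      rw [← hstart] at hD1 ⊢
      have h4 := mul_nonneg (by linarith : 0 ≤ t 1 ^ 2 - (t (1 + 1) ^ 2 - t (1 + 1)))
        (sub_nonneg.2 hD1)
      have h5 := mul_le_mul_of_nonneg_right hG (sq_nonneg ‖a 1‖)
      have h6 : (t (1 + 1) ^ 2 - t 1 ^ 2) / c * ‖a 1‖ ^ 2
        = t (1 + 1) ^ 2 / c * ‖a 1‖ ^ 2 - t 1 ^ 2 / c * ‖a 1‖ ^ 2 := by ring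
      linarith
    | succ j hj ih =>
      intro hjm
      refine le_trans ?_ (ih (by omega))
      have hs := hstep j hj
      have hsl := hslack j hj
      have hxj := hx j hj
      have hDj := hD (j + 1) (by omega)
      have h2 := htrec (j + 1) (by omega)
      have h3 := htrec2 (j + 1) (by omega)
      have hT1 := ht1 (j + 1) (by omega)
      have hW1 := ht1 (j + 1 + 1) (by omega)
      have hgain : κ * (t (j + 1) ^ 2 - t 1 ^ 2) ≤ t (j + 1) :=
        hκ ▸ gain_mul_le hw (hmono 1 (j + 1) le_rfl (by omega))
          (hU ▸ hmono (j + 1) (m + 1) (by omega) (by omega))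
      generalize t (j + 1 + 1) = W at *
      generalize t (j + 1) = T at *
      have hT0 : 0 < T := by linarith
      have hu : 0 ≤ W ^ 2 - W := by nlinarith
      have hpar : (T ^ 2 - T) / (1 + e * (T ^ 2 - T)) * ‖x j‖ ^ 2
          ≤ (T - 1) * ‖a (j + 1) - x j‖ ^ 2 + T ^ 2 / (1 + e * T ^ 2) * ‖x (j + 1)‖ ^ 2 := by
        have ha : a (j + 1) - x j = T • (x (j + 1) - x j) := by
          rw [hxj, smul_sub, smul_add, smul_smul, smul_smul, mul_one_div_cancel hT0.ne',
            mul_div_cancel₀ _ hT0.ne', one_smul]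
          module
        have huT : 0 ≤ T ^ 2 - T := by nlinarith
        have := parallel_sum_norm_sq_le (p := (T - 1) * T ^ 2) (s := T ^ 2 / (1 + e * T ^ 2))
          (m := (T ^ 2 - T) / (1 + e * (T ^ 2 - T))) ?_ ?_ (x j) (x (j + 1))
        · rw [ha, norm_smul, mul_pow, Real.norm_eq_abs, sq_abs]
          linarith
        · have : 0 ≤ (T - 1) * T ^ 2 := mul_nonneg (by linarith) (by positivity)
          positivity
        · rw [div_mul_eq_mul_div, div_le_iff₀ (by positivity)]
          refine le_of_eq ?_
          field_simp
          ring
      have hA : W ^ 2 / c - κ * (W ^ 2 - t 1 ^ 2) / (1 + c * κ)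
          ≤ T ^ 2 / c + T - κ * (T ^ 2 - t 1 ^ 2) := by
        rw [← sub_nonneg]
        have e1 : T ^ 2 / c + T - κ * (T ^ 2 - t 1 ^ 2)
            - (W ^ 2 / c - κ * (W ^ 2 - t 1 ^ 2) / (1 + c * κ))
            = ((T ^ 2 + c * T - W ^ 2) + c ^ 2 * κ * (T - κ * (T ^ 2 - t 1 ^ 2)))
              / (c * (1 + c * κ)) := by
          field_simp
          ring
        rw [e1]
        have : 0 ≤ T ^ 2 + c * T - W ^ 2 := by linarith
        have : 0 ≤ T - κ * (T ^ 2 - t 1 ^ 2) := by linarith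
        positivity
      have hBW : T ^ 2 / (1 + e * T ^ 2) - (W ^ 2 - W) / (1 + e * (W ^ 2 - W))
          ≤ T ^ 2 - (W ^ 2 - W) := div_one_add_mul_sub_le he0 hu (by linarith)
      have h4 := mul_nonneg (by linarith : 0 ≤ T ^ 2 - (W ^ 2 - W)) (sub_nonneg.2 hDj)
      have h5 := mul_le_mul_of_nonneg_right hA (sq_nonneg ‖a (j + 1)‖)
      have h6 := mul_le_mul_of_nonneg_right hBW (sq_nonneg ‖x (j + 1)‖)
      linarith
  refine le_trans ?_ (hF m hm le_rfl)
  have hs := hstep m hm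
  have hsl := hslack m hm
  rw [← hU] at hs hsl ⊢
  have hgain : κ * (U ^ 2 - t 1 ^ 2) ≤ U := hκ ▸ gain_mul_le hw hwU le_rfl
  have h1 := mul_le_mul_of_nonneg_right hgain (sq_nonneg ‖a (m + 1)‖)
  have hU1 : 0 ≤ U - 1 := by linarith
  have huU : 0 ≤ U ^ 2 - U := by nlinarith
  have hpar := parallel_sum_norm_sq_le (p := U - 1) (s := U ^ 2 / c)
    (m := (U ^ 2 - U) / (1 + e * (U ^ 2 - U))) (by positivity) (by
      rw [div_mul_eq_mul_div, div_le_iff₀ (by positivity), he]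
      refine le_of_eq ?_
      field_simp
      ring) (x m) (a (m + 1))
  linarith

end Potential

section Convexity

variable {E : Type*} [NormedAddCommGroup E] [InnerProductSpace ℝ E]

theorem StrongConvexOn.add_inner_add_norm_sq_le {f : E → ℝ} {m : ℝ}
    (hf : StrongConvexOn Set.univ m f) {x ξ : E} (hξ : ∀ z, f x + inner ℝ ξ (z - x) ≤ f z)
    (z : E) : f x + inner ℝ ξ (z - x) + m / 2 * ‖z - x‖ ^ 2 ≤ f z := by
  by_contra! hlt
  obtain ⟨d, hd⟩ : ∃ d, d = f z - f x - inner ℝ ξ (z - x) := ⟨_, rfl⟩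
  obtain ⟨M, hM⟩ : ∃ M, M = m / 2 * ‖z - x‖ ^ 2 := ⟨_, rfl⟩
  have hd0 : 0 ≤ d := by linarith [hξ z]
  have hdM : d < M := by linarith
  have hM0 : 0 < M := by linarith
  obtain ⟨θ, hθ⟩ : ∃ θ, θ = (M - d) / (2 * M) := ⟨_, rfl⟩
  have hθM : θ * M = (M - d) / 2 := by rw [hθ]; field_simp
  have hθ0 : 0 < θ := by rw [hθ]; exact div_pos (by linarith) (by linarith)
  have hθ1 : θ ≤ 1 := by rw [hθ, div_le_one (by linarith)]; linarith
  have h1 := hf.2 (Set.mem_univ z) (Set.mem_univ x) hθ0.le (by linarith : 0 ≤ 1 - θ) (by ring)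
  have h2 := hξ (θ • z + (1 - θ) • x)
  have e : θ • z + (1 - θ) • x - x = θ • (z - x) := by module
  rw [e, inner_smul_right] at h2
  simp only [smul_eq_mul] at h1
  have h3 : θ * ((1 - θ) * M) ≤ θ * d := by
    rw [hM, hd]; linarith
  have h4 := le_of_mul_le_mul_left h3 hθ0
  linarith

variable [CompleteSpace E]

theorem HasGradientAt.hasDerivAt_line {f : E → ℝ} {f' x d : E} {s : ℝ}
    (hf : HasGradientAt f f' (x + s • d)) :
    HasDerivAt (fun r : ℝ => f (x + r • d)) (inner ℝ f' d) s := by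
  have h1 : HasDerivAt (fun r : ℝ => x + r • d) d s := by
    simpa using ((hasDerivAt_id s).smul_const d).const_add x
  have h2 := hf.hasFDerivAt.comp_hasDerivAt s h1
  rw [InnerProductSpace.toDual_apply_apply] at h2
  exact h2

theorem ConvexOn.add_inner_gradient_le {f : E → ℝ} (hf : ConvexOn ℝ Set.univ f) {f' x : E}
    (hf' : HasGradientAt f f' x) (z : E) : f x + inner ℝ f' (z - x) ≤ f z := by
  have hc : ConvexOn ℝ Set.univ (fun r : ℝ => f (x + r • (z - x))) := by
    have := hf.comp_affineMap (AffineMap.lineMap x z : ℝ →ᵃ[ℝ] E)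
    refine (this.congr ?_)
    intro r _
    simp [AffineMap.lineMap_apply, add_comm]
  have hd : HasDerivAt (fun r : ℝ => f (x + r • (z - x))) (inner ℝ f' (z - x)) 0 :=
    HasGradientAt.hasDerivAt_line (by simpa using hf')
  have := hc.le_slope_of_hasDerivAt (Set.mem_univ 0) (Set.mem_univ 1) one_pos hd
  simp [slope_def_field] at this
  linarith

theorem descent_of_lipschitz_gradient {f : E → ℝ} {f' : E → E} {L : ℝ}
    (hf : ∀ y, HasGradientAt f (f' y) y) (hL : ∀ x y, ‖f' x - f' y‖ ≤ L * ‖x - y‖) (x z : E) :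
    f z ≤ f x + inner ℝ (f' x) (z - x) + L / 2 * ‖z - x‖ ^ 2 := by
  obtain ⟨d, hd⟩ : ∃ d, d = z - x := ⟨_, rfl⟩
  have hder : ∀ s : ℝ, HasDerivAt
      (fun r : ℝ => f (x + r • d) - (r * inner ℝ (f' x) d + L / 2 * ‖d‖ ^ 2 * r ^ 2))
      (inner ℝ (f' (x + s • d)) d - (inner ℝ (f' x) d + L / 2 * ‖d‖ ^ 2 * (2 * s))) s := by
    intro s
    refine (HasGradientAt.hasDerivAt_line (hf _)).sub (HasDerivAt.add ?_ ?_)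
    · simpa using (hasDerivAt_id s).mul_const (inner ℝ (f' x) d)
    · simpa using (hasDerivAt_pow 2 s).const_mul (L / 2 * ‖d‖ ^ 2)
  have hanti : AntitoneOn
      (fun r : ℝ => f (x + r • d) - (r * inner ℝ (f' x) d + L / 2 * ‖d‖ ^ 2 * r ^ 2))
      (Set.Icc 0 1) := by
    refine antitoneOn_of_deriv_nonpos (convex_Icc 0 1)
      (fun s _ => (hder s).continuousAt.continuousWithinAt)
      (fun s _ => (hder s).differentiableAt.differentiableWithinAt) ?_
    intro s hs
    rw [interior_Icc] at hs
    rw [(hder s).deriv]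
    have h1 := real_inner_le_norm (f' (x + s • d) - f' x) d
    have h2 := mul_le_mul_of_nonneg_right (hL (x + s • d) x) (norm_nonneg d)
    rw [add_sub_cancel_left, norm_smul, Real.norm_eq_abs, abs_of_pos hs.1] at h2
    rw [inner_sub_left] at h1
    linarith
  have h := hanti (Set.left_mem_Icc.2 zero_le_one) (Set.right_mem_Icc.2 zero_le_one) zero_le_one
  have e : x + d = z := by rw [hd]; abel
  simp only [one_smul, zero_smul, add_zero, e] at h
  rw [← hd]
  linarith

/-- One accelerated proximal-gradient step with momentum parameter `T`. -/
theorem composite_step_le {g1 g2 : E → ℝ} {g2' : E → E} {L m T : ℝ} (hT : 1 ≤ T)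
    (hg1 : StrongConvexOn Set.univ m g1) (hg2 : ConvexOn ℝ Set.univ g2)
    (hg2' : ∀ y, HasGradientAt g2 (g2' y) y) (hL : ∀ x y, ‖g2' x - g2' y‖ ≤ L * ‖x - y‖)
    {y y' v v' yb ξ : E} (ys : E) (hξ : ∀ z, g1 v' + inner ℝ ξ (z - v') ≤ g1 z)
    (hy' : y' = (1 / T) • v' + ((T - 1) / T) • y) (hyb : y' - yb = (1 / T) • (v' - v)) :
    T ^ 2 * (g1 y' + g2 y' - (g1 ys + g2 ys)) + T * m / 2 * ‖v' - ys‖ ^ 2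
        + (T - 1) * m / 2 * ‖v' - y‖ ^ 2
      ≤ (T ^ 2 - T) * (g1 y + g2 y - (g1 ys + g2 ys)) + T * inner ℝ (ξ + g2' yb) (v' - ys)
        + L / 2 * ‖v' - v‖ ^ 2 := by
  have hT0 : 0 < T := by linarith
  have hsum : 1 / T + (T - 1) / T = 1 := by field_simp; ring
  have hT1 : 0 ≤ (T - 1) / T := div_nonneg (by linarith) hT0.le
  have h1 := hg1.2 (Set.mem_univ v') (Set.mem_univ y) (by positivity) hT1 hsum
  rw [← hy'] at h1
  simp only [smul_eq_mul] at h1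
  have h2 := hg1.add_inner_add_norm_sq_le hξ ys
  have h3 := descent_of_lipschitz_gradient hg2' hL yb y'
  have h4 := hg2.add_inner_gradient_le (hg2' yb) y
  have h5 := hg2.add_inner_gradient_le (hg2' yb) ys
  rw [hyb, norm_smul, mul_pow, Real.norm_eq_abs, sq_abs, ← hyb] at h3
  rw [norm_sub_rev, ← neg_sub v' ys, inner_neg_right] at h2
  have e : T * inner ℝ (g2' yb) (y' - yb)
      = inner ℝ (g2' yb) (v' - ys) + (T - 1) * inner ℝ (g2' yb) (y - yb)
        + inner ℝ (g2' yb) (ys - yb) := by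
    rw [← inner_smul_right, ← inner_smul_right, ← inner_add_right, ← inner_add_right, hy']
    congr 1
    rw [smul_sub, smul_add, smul_smul, smul_smul, mul_one_div_cancel hT0.ne',
      mul_div_cancel₀ _ hT0.ne']
    module
  rw [inner_add_left]
  have h1' := mul_le_mul_of_nonneg_left h1 (sq_nonneg T)
  have h2' := mul_le_mul_of_nonneg_left h2 hT0.le
  have h3' := mul_le_mul_of_nonneg_left h3 (sq_nonneg T)
  have h4' := mul_le_mul_of_nonneg_left h4 (by nlinarith : 0 ≤ T ^ 2 - T)
  have h5' := mul_le_mul_of_nonneg_left h5 hT0.le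
  have e1 : T ^ 2 * (1 / T * g1 v' + (T - 1) / T * g1 y
      - 1 / T * ((T - 1) / T) * (m / 2 * ‖v' - y‖ ^ 2))
      = T * g1 v' + (T ^ 2 - T) * g1 y - (T - 1) * m / 2 * ‖v' - y‖ ^ 2 := by
    field_simp
  have e3 : T ^ 2 * (g2 yb + inner ℝ (g2' yb) (y' - yb) + L / 2 * ((1 / T) ^ 2 * ‖v' - v‖ ^ 2))
      = T ^ 2 * g2 yb + T * (T * inner ℝ (g2' yb) (y' - yb)) + L / 2 * ‖v' - v‖ ^ 2 := by
    field_simp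
  rw [e1] at h1'
  rw [e3, e] at h3'
  linarith

end Convexity

section Dual

variable {E F : Type*} [NormedAddCommGroup E] [InnerProductSpace ℝ E] [CompleteSpace E]
  [NormedAddCommGroup F] [InnerProductSpace ℝ F] [CompleteSpace F]

/-- The multiplier terms of one step, written as differences of squared norms. -/
theorem multiplier_step_eq (B : E →L[ℝ] F) {β γ T : ℝ} (hβ : 0 < β) (hγ : 0 < γ) (hT : 0 < T)
    {a a' h : E} {l l' lb ls : F} (hlb : lb = l + (γ * T) • B a) (hl' : l' = l + (γ * T) • B a')
    (ha : a' - a = -((β / T) • (h + ContinuousLinearMap.adjoint B lb))) :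
    T * inner ℝ h a' + T * inner ℝ ls (B a') =
      T ^ 2 / (2 * β) * (‖a‖ ^ 2 - ‖a'‖ ^ 2 - ‖a' - a‖ ^ 2)
      + 1 / (2 * γ) * (‖l - ls‖ ^ 2 - ‖l' - ls‖ ^ 2)
      + γ * T ^ 2 / 2 * (‖B (a' - a)‖ ^ 2 - ‖B a‖ ^ 2) := by
  have hh : h = -((T / β) • (a' - a)) - ContinuousLinearMap.adjoint B lb := by
    rw [ha, smul_neg, neg_neg, smul_smul, div_mul_div_cancel₀ hβ.ne', div_self hT.ne', one_smul]
    abel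
  have hls : l' - ls = (l - ls) + (γ * T) • B a' := by rw [hl']; abel
  rw [hh, inner_sub_left, ContinuousLinearMap.adjoint_inner_left, inner_neg_left,
    inner_smul_left, inner_sub_left, hls, norm_add_sq_real, norm_smul, inner_smul_right, hlb,
    inner_add_left, inner_smul_left, map_sub, norm_sub_sq_real (B a'), norm_sub_sq_real a',
    inner_sub_left l ls, real_inner_self_eq_norm_sq, mul_pow, Real.norm_eq_abs, sq_abs,
    real_inner_comm a' a, real_inner_comm (B a') (B a)]
  simp only [conj_trivial]
  field_simp
  ring

end Dual

/-- A bounded multiplier sequence forces the weighted residuals `t k ^ 2 • r k` to be bounded. -/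
theorem norm_weighted_residual_le {F : Type*} [NormedAddCommGroup F] [NormedSpace ℝ F]
    {t : ℕ → ℝ} (ht1 : ∀ k ≥ 1, 1 ≤ t k) (htrec : ∀ k ≥ 1, t (k + 1) ^ 2 ≤ t k ^ 2 + t (k + 1))
    {γ M : ℝ} (hγ : 0 < γ) {r l : ℕ → F}
    (hl : ∀ k ≥ 1, l (k + 1) - l k =
      γ • (t (k + 1) ^ 2 • r (k + 1) - (t (k + 1) ^ 2 - t (k + 1)) • r k))
    (hM : ∀ k ≥ 1, ‖l k - l 1‖ ≤ M) {K : ℕ} (hK : 1 ≤ K) :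
    t K ^ 2 * ‖r K‖ ≤ 2 * (t 1 ^ 2 * ‖r 1‖ + M / γ) := by
  obtain ⟨X, hX⟩ : ∃ X : ℕ → F, ∀ k, X k = t 1 ^ 2 • r 1 + γ⁻¹ • (l k - l 1) := ⟨_, fun _ => rfl⟩
  have hXC : ∀ k ≥ 1, ‖X k‖ ≤ t 1 ^ 2 * ‖r 1‖ + M / γ := by
    intro k hk
    rw [hX]
    refine (norm_add_le _ _).trans ?_
    rw [norm_smul, norm_smul, norm_inv, Real.norm_of_nonneg (sq_nonneg (t 1)),
      Real.norm_of_nonneg hγ.le, inv_mul_eq_div]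
    gcongr
    exact hM k hk
  have hS : ∀ k ≥ 1, ‖X k - t k ^ 2 • r k‖ ≤ t 1 ^ 2 * ‖r 1‖ + M / γ := by
    intro k hk
    induction k, hk using Nat.le_induction with
    | base =>
      have h0 := (norm_nonneg _).trans (hXC 1 le_rfl)
      simpa [hX] using h0
    | succ k hk ih =>
      have htk := ht1 k hk
      have htk' := ht1 (k + 1) (by omega)
      have hrec := htrec k hk
      obtain ⟨θ, hθ⟩ : ∃ θ, θ = (t k ^ 2 - t (k + 1) ^ 2 + t (k + 1)) / t k ^ 2 := ⟨_, rfl⟩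
      have hθt : θ * t k ^ 2 = t k ^ 2 - t (k + 1) ^ 2 + t (k + 1) := by
        rw [hθ, div_mul_cancel₀ _ (by positivity)]
      have hθ0 : 0 ≤ θ := by
        rw [hθ]; exact div_nonneg (by linarith) (by positivity)
      have hθ1 : θ ≤ 1 := by
        rw [hθ, div_le_one (by positivity)]; nlinarith
      have hstep : X (k + 1) = X k + (t (k + 1) ^ 2 • r (k + 1)
          - (t (k + 1) ^ 2 - t (k + 1)) • r k) := by
        have : l (k + 1) - l 1 = (l k - l 1) + (l (k + 1) - l k) := by abel
        rw [hX, hX, this, smul_add, hl k hk, smul_smul, inv_mul_cancel₀ hγ.ne', one_smul]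
        abel
      have e : X (k + 1) - t (k + 1) ^ 2 • r (k + 1)
          = (1 - θ) • (X k - t k ^ 2 • r k) + θ • X k := by
        have h2 : (1 - θ) • (X k - t k ^ 2 • r k) + θ • X k
            = X k - (t k ^ 2 - θ * t k ^ 2) • r k := by module
        rw [h2, hθt, hstep]
        module
      rw [e]
      refine (norm_add_le _ _).trans ?_
      rw [norm_smul, norm_smul, Real.norm_of_nonneg hθ0,
        Real.norm_of_nonneg (by linarith : 0 ≤ 1 - θ)]
      have h1 := mul_le_mul_of_nonneg_left ih (by linarith : 0 ≤ 1 - θ)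
      have h2 := mul_le_mul_of_nonneg_left (hXC k hk) hθ0
      linarith
  have h := norm_sub_le (X K) (X K - t K ^ 2 • r K)
  rw [sub_sub_cancel, norm_smul, Real.norm_of_nonneg (sq_nonneg (t K))] at h
  linarith [hXC K hK, hS K hK]

/-- Accelerated linearized ALM based on Nesterov's first scheme (Algorithm 4),
strongly convex case (Theorem 2.6): convergence rates for the one-block linearly
constrained problem `min g1 + g2 s.t. By = b`. -/
theorem stmt10 {n p : ℕ}
    (B : EuclideanSpace ℝ (Fin n) →L[ℝ] EuclideanSpace ℝ (Fin p))
    (b : EuclideanSpace ℝ (Fin p))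
    (g1 g2 : EuclideanSpace ℝ (Fin n) → ℝ)
    (g2' : EuclideanSpace ℝ (Fin n) → EuclideanSpace ℝ (Fin n))
    (Lg2 μ : ℝ) (hLg2 : 0 ≤ Lg2) (hμ : 0 < μ)
    (hg1lsc : LowerSemicontinuous g1) (hg1sc : StrongConvexOn Set.univ μ g1)
    (hg2conv : ConvexOn ℝ Set.univ g2)
    (hg2grad : ∀ y, HasGradientAt g2 (g2' y) y)
    (hg2lip : ∀ x y, ‖g2' x - g2' y‖ ≤ Lg2 * ‖x - y‖)
    (β γ : ℝ) (hβ : 0 < β) (hγ : 0 < γ)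
    (t : ℕ → ℝ) (ht1 : ∀ k ≥ 1, 1 ≤ t k) (htmono : ∀ k ≥ 1, t k ≤ t (k + 1))
    (hβle : β ≤ t 1 ^ 2 / (Lg2 + t 1 ^ 2 * γ * ‖B‖ ^ 2))
    (htrec : ∀ k ≥ 1, t (k + 1) ^ 2 ≤ t k ^ 2 + t (k + 1))
    (htrec2 : ∀ k ≥ 1, t (k + 1) ^ 2 ≤ t k ^ 2 + β * μ * t k)
    (y v ybar : ℕ → EuclideanSpace ℝ (Fin n))
    (lam lambar : ℕ → EuclideanSpace ℝ (Fin p))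
    (ζ : ℕ → EuclideanSpace ℝ (Fin n))
    (hy0 : y 0 = y 1) (hv1 : v 1 = y 1)
    (hybar : ∀ k ≥ 1, ybar k = y k + ((t k - 1) / t (k + 1)) • (y k - y (k - 1)))
    (hlambar : ∀ k ≥ 1, lambar (k + 1) = lam k + (γ * t (k + 1)) • (B (v k) - b))
    (hζ : ∀ k ≥ 1, ∀ z, g1 (v (k + 1)) + ⟪ζ (k + 1), z - v (k + 1)⟫ ≤ g1 z)
    (hv : ∀ k ≥ 1, v (k + 1) - v k =
      -((β / t (k + 1)) • (ζ (k + 1) + g2' (ybar k) +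
        ContinuousLinearMap.adjoint B (lambar (k + 1)))))
    (hyupd : ∀ k ≥ 1, y (k + 1) =
      (1 / t (k + 1)) • v (k + 1) + ((t (k + 1) - 1) / t (k + 1)) • y k)
    (hlam : ∀ k ≥ 1, lam (k + 1) = lam k + (γ * t (k + 1)) • (B (v (k + 1)) - b))
    -- saddle point of the Lagrangian `𝓛(y,λ) = g1 y + g2 y + ⟪λ, B y − b⟫`
    (ys : EuclideanSpace ℝ (Fin n)) (lams : EuclideanSpace ℝ (Fin p))
    (hsaddle : ∀ (yy : EuclideanSpace ℝ (Fin n)) (ll : EuclideanSpace ℝ (Fin p)),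
      g1 ys + g2 ys + ⟪ll, B ys - b⟫ ≤ g1 ys + g2 ys + ⟪lams, B ys - b⟫ ∧
      g1 ys + g2 ys + ⟪lams, B ys - b⟫ ≤ g1 yy + g2 yy + ⟪lams, B yy - b⟫) :
    let E1 : ℝ :=
      t 1 ^ 2 * (g1 (y 1) + g2 (y 1) - (g1 ys + g2 ys) + ⟪lams, B (y 1) - b⟫) +
      t 1 ^ 2 / (2 * β) * ‖y 1 - ys‖ ^ 2 + 1 / (2 * γ) * ‖lam 1 - lams‖ ^ 2
    let C4 : ℝ :=
      3 * t 1 ^ 2 * ‖B (y 1) - b‖ +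
        (2 * ‖lam 1 - lams‖ + 2 * Real.sqrt (2 * γ * E1)) / γ
    ∀ k ≥ 1,
      ‖B (y k) - b‖ ≤ C4 / t k ^ 2 ∧
      |g1 (y k) + g2 (y k) - (g1 ys + g2 ys)| ≤ (E1 + C4 * ‖lams‖) / t k ^ 2 := by
  intro E1 C4
  have hw := ht1 1 le_rfl
  have hw2 : 0 < t 1 ^ 2 := by positivity
  have hden : β * (Lg2 + t 1 ^ 2 * γ * ‖B‖ ^ 2) ≤ t 1 ^ 2 := by
    have h0 : 0 ≤ Lg2 + t 1 ^ 2 * γ * ‖B‖ ^ 2 := by positivity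
    rcases h0.eq_or_lt with h | h
    · rw [← h, mul_zero]
      exact hw2.le
    · rwa [le_div_iff₀ h] at hβle
  have hBz : ∀ z, t 1 ^ 2 * (β * γ * ‖B z‖ ^ 2) ≤ t 1 ^ 2 * ‖z‖ ^ 2 - β * Lg2 * ‖z‖ ^ 2 := by
    intro z
    have h1 : ‖B z‖ ^ 2 ≤ ‖B‖ ^ 2 * ‖z‖ ^ 2 := by
      rw [← mul_pow]; gcongr; exact B.le_opNorm z
    have h2 : t 1 ^ 2 * (β * γ * ‖B z‖ ^ 2) ≤ t 1 ^ 2 * (β * γ * (‖B‖ ^ 2 * ‖z‖ ^ 2)) := by gcongr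
    have h3 := mul_le_mul_of_nonneg_right hden (sq_nonneg ‖z‖)
    linarith
  have hρ : ∀ z, β * γ * ‖B z‖ ^ 2 ≤ ‖z‖ ^ 2 := by
    intro z
    refine le_of_mul_le_mul_left ?_ hw2
    have : 0 ≤ β * Lg2 * ‖z‖ ^ 2 := by positivity
    linarith [hBz z]
  have hBys : B ys = b := by
    have h := (hsaddle ys (lams + (B ys - b))).1
    rw [inner_add_left, real_inner_self_eq_norm_sq] at h
    have h0 : ‖B ys - b‖ ^ 2 = 0 := le_antisymm (by linarith) (sq_nonneg _)
    exact sub_eq_zero.1 (norm_eq_zero.1 (pow_eq_zero_iff two_ne_zero |>.1 h0))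
  have hBsub : ∀ z, B z - b = B (z - ys) := fun z => by rw [map_sub, hBys]
  obtain ⟨G, hG⟩ : ∃ G : ℕ → ℝ, ∀ k, G k =
    g1 (y k) + g2 (y k) - (g1 ys + g2 ys) + ⟪lams, B (y k) - b⟫ := ⟨_, fun _ => rfl⟩
  have hGnorm : ∀ k, μ / 2 * ‖y k - ys‖ ^ 2 ≤ G k := by
    intro k
    have hlin : ConvexOn ℝ Set.univ (fun z => ⟪lams, B z - b⟫) := by
      refine ⟨convex_univ, fun z _ z' _ s s' _ _ hs => le_of_eq ?_⟩
      simp only [hBsub, smul_eq_mul]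
      rw [← inner_smul_right, ← inner_smul_right, ← inner_add_right, ← map_smul, ← map_smul,
        ← map_add]
      congr 2
      have : ys = s • ys + s' • ys := by rw [← add_smul, hs, one_smul]
      rw [smul_sub, smul_sub]
      nth_rewrite 1 [this]
      abel
    have hsc : StrongConvexOn Set.univ μ (g1 + (g2 + fun z => ⟪lams, B z - b⟫)) := by
      have := UniformConvexOn.add hg1sc (uniformConvexOn_zero.2 (hg2conv.add hlin))
      rwa [add_zero] at this
    have h := hsc.add_inner_add_norm_sq_le (x := ys) (ξ := 0) (fun z => by
      have := (hsaddle z lams).2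
      simp only [Pi.add_apply, inner_zero_left]
      linarith) (y k)
    simp only [Pi.add_apply, inner_zero_left, hBys, sub_self, inner_zero_right] at h
    rw [hG]
    linarith
  have hvy : ∀ k ≥ 1, (t k - 1) • (y k - y (k - 1)) = v k - y k := by
    intro k hk
    obtain ⟨m, rfl⟩ : ∃ m, k = m + 1 := ⟨k - 1, by omega⟩
    rcases Nat.eq_zero_or_pos m with rfl | hm
    · simp [hy0, hv1]
    have hT0 : t (m + 1) ≠ 0 := by linarith [ht1 (m + 1) hk]
    have h : t (m + 1) • y (m + 1) = v (m + 1) + (t (m + 1) - 1) • y m := by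
      rw [hyupd m hm, smul_add, smul_smul, smul_smul, mul_one_div_cancel hT0,
        mul_div_cancel₀ _ hT0, one_smul]
    rw [add_tsub_cancel_right, smul_sub, ← sub_eq_zero]
    have : v (m + 1) = t (m + 1) • y (m + 1) - (t (m + 1) - 1) • y m := by rw [h]; abel
    rw [this]
    module
  have hstep : ∀ k ≥ 1,
      t (k + 1) ^ 2 * G (k + 1) + t (k + 1) * μ / 2 * ‖v (k + 1) - ys‖ ^ 2
        + (t (k + 1) - 1) * μ / 2 * ‖v (k + 1) - y k‖ ^ 2
      ≤ (t (k + 1) ^ 2 - t (k + 1)) * G k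
        + t (k + 1) ^ 2 / (2 * β) * (‖v k - ys‖ ^ 2 - ‖v (k + 1) - ys‖ ^ 2 - ‖v (k + 1) - v k‖ ^ 2)
        + 1 / (2 * γ) * (‖lam k - lams‖ ^ 2 - ‖lam (k + 1) - lams‖ ^ 2)
        + γ * t (k + 1) ^ 2 / 2 * (‖B (v (k + 1) - v k)‖ ^ 2 - ‖B (v k - ys)‖ ^ 2)
        + Lg2 / 2 * ‖v (k + 1) - v k‖ ^ 2 := by
    intro k hk
    have hT := ht1 (k + 1) (by omega)
    have hT0 : 0 < t (k + 1) := by linarith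
    have hyb : y (k + 1) - ybar k = (1 / t (k + 1)) • (v (k + 1) - v k) := by
      rw [hybar k hk, hyupd k hk, div_eq_inv_mul (t k - 1), mul_smul, hvy k hk]
      match_scalars <;> field_simp <;> ring
    have h1 := composite_step_le hT hg1sc hg2conv hg2grad hg2lip ys (hζ k hk) (hyupd k hk) hyb
    have hsub : v (k + 1) - v k = (v (k + 1) - ys) - (v k - ys) := by abel
    have h2 := multiplier_step_eq B (l := lam k) (ls := lams) hβ hγ hT0
      (by rw [hlambar k hk, hBsub]) (hBsub (v (k + 1)) ▸ hlam k hk)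
      ((hsub.symm.trans (hv k hk)))
    rw [← hsub] at h2
    have h3 : t (k + 1) ^ 2 * ⟪lams, B (y (k + 1)) - b⟫
        = (t (k + 1) ^ 2 - t (k + 1)) * ⟪lams, B (y k) - b⟫
          + t (k + 1) * ⟪lams, B (v (k + 1) - ys)⟫ := by
      rw [hBsub, hBsub, ← inner_smul_right, ← inner_smul_right, ← inner_smul_right,
        ← inner_add_right, ← map_smul, ← map_smul, ← map_smul, ← map_add, hyupd k hk]
      congr 2
      match_scalars <;> field_simp <;> ring
    rw [hG, hG]
    linarith
  have hE : ∀ k ≥ 1, t k ^ 2 * G k + 1 / (2 * γ) * ‖lam k - lams‖ ^ 2 ≤ E1 := by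
    intro k hk
    have h := energy_le_of_step B (c := β * μ) (ρ := β * γ) (by positivity) (by positivity) hρ
      (D := fun k => 2 / μ * G k) (Λ := fun k => 1 / (γ * μ) * ‖lam k - lams‖ ^ 2)
      (a := fun k => v k - ys) (x := fun k => y k - ys) ht1 htmono htrec htrec2
      (by rw [hv1]) ?_ ?_ ?_ hk
    · have h1 := mul_le_mul_of_nonneg_left h (by positivity : 0 ≤ μ / 2)
      rw [hv1, hG 1] at h1
      calc _ = μ / 2 * (t k ^ 2 * (2 / μ * G k) + 1 / (γ * μ) * ‖lam k - lams‖ ^ 2) := by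
            field_simp
        _ ≤ _ := h1
        _ = E1 := by
            simp only [E1]
            field_simp
    · intro k hk
      have hT0 : t (k + 1) ≠ 0 := by linarith [ht1 (k + 1) (by omega)]
      simp only [hyupd k hk]
      match_scalars <;> field_simp <;> ring
    · intro k _
      have := mul_le_mul_of_nonneg_left (hGnorm k) (by positivity : 0 ≤ 2 / μ)
      calc _ = 2 / μ * (μ / 2 * ‖y k - ys‖ ^ 2) := by field_simp
        _ ≤ _ := this
    · intro k hk
      simp only [sub_sub_sub_cancel_right]
      have hs := hstep k hk
      have hq := hBz (v (k + 1) - v k)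
      have h0 : 0 ≤ β * γ * t 1 ^ 2 * ‖B (v k - ys)‖ ^ 2 := by positivity
      generalize t (k + 1) = T at *
      generalize ‖v (k + 1) - v k‖ ^ 2 = n1 at *
      generalize ‖B (v (k + 1) - v k)‖ ^ 2 = n2 at *
      generalize ‖B (v k - ys)‖ ^ 2 = n3 at *
      have hsl : (T ^ 2 - t 1 ^ 2) * ((n1 - β * γ * n2 + β * γ * n3) / (β * μ))
          ≤ 2 / μ * (T ^ 2 / (2 * β) * n1 - γ * T ^ 2 / 2 * (n2 - n3) - Lg2 / 2 * n1) := by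
        rw [← sub_nonneg]
        have e : 2 / μ * (T ^ 2 / (2 * β) * n1 - γ * T ^ 2 / 2 * (n2 - n3) - Lg2 / 2 * n1)
            - (T ^ 2 - t 1 ^ 2) * ((n1 - β * γ * n2 + β * γ * n3) / (β * μ))
            = (t 1 ^ 2 * n1 - β * Lg2 * n1 - t 1 ^ 2 * (β * γ * n2) + β * γ * t 1 ^ 2 * n3)
              / (β * μ) := by
          field_simp
          ring
        rw [e]
        exact div_nonneg (by linarith) (by positivity)
      have hs' := mul_le_mul_of_nonneg_left hs (by positivity : 0 ≤ 2 / μ)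
      have e1 : ∀ s z : ℝ, 2 / μ * (s * μ / 2 * z) = s * z := by
        intro s z; field_simp
      have e2 : ∀ z : ℝ, 2 / μ * (T ^ 2 / (2 * β) * z) = T ^ 2 / (β * μ) * z := by
        intro z; field_simp
      have e3 : ∀ z : ℝ, 2 / μ * (1 / (2 * γ) * z) = 1 / (γ * μ) * z := by
        intro z; field_simp
      have e4 := e1 T (‖v (k + 1) - ys‖ ^ 2)
      have e5 := e1 (T - 1) (‖v (k + 1) - y k‖ ^ 2)
      have e6 := e2 (‖v k - ys‖ ^ 2)
      have e7 := e2 (‖v (k + 1) - ys‖ ^ 2)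
      have e8 := e3 (‖lam k - lams‖ ^ 2)
      have e9 := e3 (‖lam (k + 1) - lams‖ ^ 2)
      linarith
  have hG0 : ∀ k, 0 ≤ G k := fun k => le_trans (by positivity) (hGnorm k)
  have hlamnorm : ∀ k ≥ 1, ‖lam k - lams‖ ≤ √(2 * γ * E1) := by
    intro k hk
    refine Real.le_sqrt_of_sq_le ?_
    have h1 := hE k hk
    have h2 : 0 ≤ t k ^ 2 * G k := mul_nonneg (sq_nonneg _) (hG0 k)
    have h3 : 1 / (2 * γ) * ‖lam k - lams‖ ^ 2 ≤ E1 := by linarith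
    rw [one_div_mul_eq_div, div_le_iff₀ (by positivity)] at h3
    linarith
  have hfeas : ∀ k ≥ 1, t k ^ 2 * ‖B (y k) - b‖ ≤ C4 := by
    intro k hk
    have h := norm_weighted_residual_le (M := ‖lam 1 - lams‖ + √(2 * γ * E1)) ht1 htrec hγ
      (r := fun k => B (y k) - b) (l := lam) ?_ ?_ hk
    · refine h.trans ?_
      have h0 : 0 ≤ t 1 ^ 2 * ‖B (y 1) - b‖ := by positivity
      simp only [C4]
      have e : 2 * ((‖lam 1 - lams‖ + √(2 * γ * E1)) / γ)
        = (2 * ‖lam 1 - lams‖ + 2 * √(2 * γ * E1)) / γ := by ring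
      linarith
    · intro k hk
      have hT0 : t (k + 1) ≠ 0 := by linarith [ht1 (k + 1) (by omega)]
      rw [hlam k hk, add_sub_cancel_left, mul_smul]
      simp only [hBsub]
      congr 1
      rw [← map_smul, ← map_smul, ← map_smul, ← map_sub, hyupd k hk]
      congr 1
      match_scalars <;> field_simp <;> ring
    · intro k hk
      have : lam k - lam 1 = (lam k - lams) - (lam 1 - lams) := by abel
      rw [this]
      exact (norm_sub_le _ _).trans (by linarith [hlamnorm k hk])
  intro k hk
  have hk2 : 0 < t k ^ 2 := pow_pos (by linarith [ht1 k hk]) 2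
  have hr := hfeas k hk
  refine ⟨by rw [le_div_iff₀ hk2]; linarith, ?_⟩
  rw [le_div_iff₀ hk2, ← abs_of_pos hk2, ← abs_mul]
  have h1 : t k ^ 2 * G k ≤ E1 := by
    have := hE k hk
    have : 0 ≤ 1 / (2 * γ) * ‖lam k - lams‖ ^ 2 := by positivity
    linarith
  have h2 : 0 ≤ t k ^ 2 * G k := mul_nonneg hk2.le (hG0 k)
  have h3 : t k ^ 2 * |⟪lams, B (y k) - b⟫| ≤ C4 * ‖lams‖ := by
    calc _ ≤ t k ^ 2 * (‖lams‖ * ‖B (y k) - b‖) := by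
          gcongr
          exact abs_real_inner_le_norm _ _
      _ = (t k ^ 2 * ‖B (y k) - b‖) * ‖lams‖ := by ring
      _ ≤ _ := by gcongr
  have h4 : (g1 (y k) + g2 (y k) - (g1 ys + g2 ys)) * t k ^ 2
      = t k ^ 2 * G k - t k ^ 2 * ⟪lams, B (y k) - b⟫ := by rw [hG]; ring
  rw [h4]
  refine (abs_sub _ _).trans ?_
  rw [abs_of_nonneg h2, abs_mul, abs_of_pos hk2]
  linarith
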